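/- arXiv:1802.04522 — 3 statements merged into one kernel-verified Lean document; each statement's English description precedes it below -/
import Mathlib

section
/- Let Q₁, Q₂ ∈ ℝ^{n×n} be symmetric matrices. Suppose there exists x̄ ∈ ℝⁿ with x̄ᵀQ₁x̄ < 0 (strict feasibility), and suppose that for all x ∈ ℝⁿ, xᵀQ₁x ≤ 0 implies xᵀQ₂x ≤ 0. Then there exists λ ≥ 0 such that λQ₁ − Q₂ is positive semidefinite. (Homogeneous S-procedure / S-lemma, necessity direction.) -/
open Matrix

lemma scalar_aux (a b c A B C : ℝ) (ha : 0 < a) (hc : c < 0)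
    (h : ∀ t : ℝ, a + t * b + t ^ 2 * c ≤ 0 → A + t * B + t ^ 2 * C ≤ 0) : C * a ≤ A * c := by
  have hac : a * c < 0 := mul_neg_of_pos_of_neg ha hc
  have hd : 0 < b ^ 2 - 4 * a * c := by nlinarith [sq_nonneg b]
  obtain ⟨s, hs, hs2⟩ : ∃ s : ℝ, 0 < s ∧ s ^ 2 = b ^ 2 - 4 * a * c :=
    ⟨_, Real.sqrt_pos.2 hd, Real.sq_sqrt hd.le⟩
  have hc0 : c ≠ 0 := hc.ne
  have e1 : a + ((-b + s) / (2 * c)) * b + ((-b + s) / (2 * c)) ^ 2 * c = 0 := by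
    field_simp
    linear_combination hs2
  have e2 : a + ((-b - s) / (2 * c)) * b + ((-b - s) / (2 * c)) ^ 2 * c = 0 := by
    field_simp
    linear_combination hs2
  have h1 := h _ e1.le
  have h2 := h _ e2.le
  have hb : b < s := by nlinarith
  have hb' : -b < s := by nlinarith
  have key : (s - b) * (A + ((-b - s) / (2 * c)) * B + ((-b - s) / (2 * c)) ^ 2 * C)
      + (s + b) * (A + ((-b + s) / (2 * c)) * B + ((-b + s) / (2 * c)) ^ 2 * C)
      = 2 * s * (A - C * a / c) := by
    field_simp
    linear_combination (2 * C * s) * hs2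
  have h3 : 2 * s * (A - C * a / c) ≤ 0 := by
    rw [← key]
    nlinarith [mul_nonneg (sub_pos.2 hb).le (neg_nonneg.2 h2),
      mul_nonneg (by linarith : 0 ≤ s + b) (neg_nonneg.2 h1)]
  have h4 : A - C * a / c ≤ 0 := by
    by_contra hh
    push Not at hh
    have := mul_pos (by linarith : 0 < 2 * s) hh
    linarith
  have h5 : A ≤ C * a / c := by linarith
  rwa [le_div_iff_of_neg hc] at h5

lemma quad_expand {n : ℕ} (Q : Matrix (Fin n) (Fin n) ℝ) (x y : Fin n → ℝ) (t : ℝ) :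
    (x + t • y) ⬝ᵥ Q.mulVec (x + t • y) = x ⬝ᵥ Q.mulVec x
      + t * (x ⬝ᵥ Q.mulVec y + y ⬝ᵥ Q.mulVec x) + t ^ 2 * (y ⬝ᵥ Q.mulVec y) := by
  simp only [mulVec_add, mulVec_smul, dotProduct_add, add_dotProduct, smul_dotProduct,
    dotProduct_smul, smul_eq_mul]
  ring

/-- homogeneous S-procedure / S-lemma, necessity direction. -/
theorem stmt4 (n : ℕ) (Q₁ Q₂ : Matrix (Fin n) (Fin n) ℝ)
    (hQ₁ : Q₁.IsSymm) (hQ₂ : Q₂.IsSymm)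
    (hstrict : ∃ xbar : Fin n → ℝ, xbar ⬝ᵥ Q₁.mulVec xbar < 0)
    (h : ∀ x : Fin n → ℝ, x ⬝ᵥ Q₁.mulVec x ≤ 0 → x ⬝ᵥ Q₂.mulVec x ≤ 0) :
    ∃ l : ℝ, 0 ≤ l ∧ (l • Q₁ - Q₂).PosSemidef := by
  let S : Set ℝ := {r | ∃ y : Fin n → ℝ, y ⬝ᵥ Q₁.mulVec y < 0 ∧
    r = (y ⬝ᵥ Q₂.mulVec y) / (y ⬝ᵥ Q₁.mulVec y)}
  have hne : S.Nonempty := by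
    obtain ⟨y, hy⟩ := hstrict
    exact ⟨_, y, hy, rfl⟩
  have h0 : ∀ r ∈ S, 0 ≤ r := by
    rintro r ⟨y, hy, rfl⟩
    exact div_nonneg_of_nonpos (h y hy.le) hy.le
  refine ⟨sInf S, le_csInf hne h0, ?_⟩
  refine PosSemidef.of_dotProduct_mulVec_nonneg ?_ ?_
  · rw [IsHermitian, conjTranspose_eq_transpose_of_trivial, transpose_sub, transpose_smul,
      hQ₁.eq, hQ₂.eq]
  · intro x
    simp only [star_trivial, sub_mulVec, smul_mulVec, dotProduct_sub, dotProduct_smul,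
      smul_eq_mul, sub_nonneg]
    rcases lt_trichotomy (x ⬝ᵥ Q₁.mulVec x) 0 with hx | hx | hx
    · have : sInf S ≤ _ := csInf_le ⟨0, h0⟩ ⟨x, hx, rfl⟩
      rwa [le_div_iff_of_neg hx] at this
    · rw [hx, mul_zero]
      exact h x hx.le
    · rw [← div_le_iff₀ hx]
      refine le_csInf hne ?_
      rintro r ⟨y, hy, rfl⟩
      rw [le_div_iff_of_neg hy, div_mul_eq_mul_div, le_div_iff₀ hx]
      refine scalar_aux _ (x ⬝ᵥ Q₁.mulVec y + y ⬝ᵥ Q₁.mulVec x) _ _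
        (x ⬝ᵥ Q₂.mulVec y + y ⬝ᵥ Q₂.mulVec x) _ hx hy ?_
      intro t ht
      rw [← quad_expand] at ht ⊢
      exact h _ ht
end

section
/- Let C ⊆ ℝⁿ and C' ⊆ ℝᵖ be compact convex sets, let A : ℝⁿ → ℝᵐ and E : ℝᵖ → ℝᵐ be linear maps, and let c ∈ ℝᵐ. Then A '' C + c ⊆ E '' C' if and only if r(E, 0)^{−T} τ(C')* ⊆ r(A, c)^{−T} τ(C)*, i.e., every y ∈ ℝᵐ × ℝ with r(E, 0)ᵀ y ∈ τ(C')* also satisfies r(A, c)ᵀ y ∈ τ(C)*. (Dual characterization of the invariance condition of a discrete-time affine hybrid algebraic system.) -/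
open scoped RealInnerProductSpace

/-- `τ(S) = {(λ x, λ) : λ ≥ 0, x ∈ S}`, the conic hull of the lifted set `S × {1}`,
viewed inside `ℝⁿ × ℝ` equipped with the standard Euclidean inner product. -/
def tau {V : Type*} [AddCommMonoid V] [Module ℝ V] (S : Set V) : Set (WithLp 2 (V × ℝ)) :=
  {p | ∃ l : ℝ, 0 ≤ l ∧ ∃ x ∈ S, p = (WithLp.equiv 2 (V × ℝ)).symm (l • x, l)}

/-- `r(A, c)` as a linear map on plain products: `r(A,c)(x, z) = (A x + z c, z)`. -/
def rProd {V W : Type*} [AddCommGroup V] [Module ℝ V] [AddCommGroup W] [Module ℝ W]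
    (A : V →ₗ[ℝ] W) (c : W) : (V × ℝ) →ₗ[ℝ] (W × ℝ) where
  toFun p := (A p.1 + p.2 • c, p.2)
  map_add' p q := by
    simp only [Prod.fst_add, map_add, Prod.snd_add, add_smul, Prod.mk_add_mk]
    exact Prod.ext (by abel_nf) rfl
  map_smul' r p := by
    simp only [Prod.smul_fst, map_smul, Prod.smul_snd, smul_eq_mul, mul_smul,
      RingHom.id_apply, Prod.smul_mk, smul_add]

/-- `r(A, c)` as a linear map between the Euclidean spaces `ℝⁿ × ℝ` and `ℝᵐ × ℝ`. -/
noncomputable def rmap {V W : Type*} [AddCommGroup V] [Module ℝ V] [AddCommGroup W]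
    [Module ℝ W] (A : V →ₗ[ℝ] W) (c : W) :
    WithLp 2 (V × ℝ) →ₗ[ℝ] WithLp 2 (W × ℝ) :=
  (WithLp.linearEquiv 2 ℝ (W × ℝ)).symm.toLinearMap ∘ₗ
    (rProd A c) ∘ₗ (WithLp.linearEquiv 2 ℝ (V × ℝ)).toLinearMap

theorem dual_iff {n m : ℕ} (C : Set (EuclideanSpace ℝ (Fin n)))
    (A : EuclideanSpace ℝ (Fin n) →ₗ[ℝ] EuclideanSpace ℝ (Fin m))
    (c : EuclideanSpace ℝ (Fin m)) (y : WithLp 2 (EuclideanSpace ℝ (Fin m) × ℝ)) :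
    LinearMap.adjoint (rmap A c) y ∈ {w | ∀ k ∈ tau C, 0 ≤ ⟪k, w⟫} ↔
      ∀ x ∈ C, 0 ≤ ⟪A x + c, y.fst⟫ + y.snd := by
  have key : ∀ (l : ℝ) (x : EuclideanSpace ℝ (Fin n)),
      ⟪(WithLp.equiv 2 (EuclideanSpace ℝ (Fin n) × ℝ)).symm (l • x, l),
        LinearMap.adjoint (rmap A c) y⟫ = l * (⟪A x + c, y.fst⟫ + y.snd) := by
    intro l x
    rw [LinearMap.adjoint_inner_right, WithLp.prod_inner_apply]
    simp [rmap, rProd, inner_add_left, inner_smul_left]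
    ring
  constructor
  · intro h x hx
    have := h _ ⟨1, zero_le_one, x, hx, rfl⟩
    rw [key, one_mul] at this
    exact this
  · rintro h k ⟨l, hl, x, hx, rfl⟩
    rw [key]
    exact mul_nonneg hl (h x hx)

/-- dual characterization of the invariance condition
`A '' C + c ⊆ E '' C'` for compact convex sets `C`, `C'`:
it holds iff `r(E, 0)⁻ᵀ τ(C')* ⊆ r(A, c)⁻ᵀ τ(C)*`. -/
theorem stmt10 (n p m : ℕ)
    (C : Set (EuclideanSpace ℝ (Fin n))) (C' : Set (EuclideanSpace ℝ (Fin p)))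
    (hCcpt : IsCompact C) (hCconv : Convex ℝ C)
    (hC'cpt : IsCompact C') (hC'conv : Convex ℝ C')
    (A : EuclideanSpace ℝ (Fin n) →ₗ[ℝ] EuclideanSpace ℝ (Fin m))
    (E : EuclideanSpace ℝ (Fin p) →ₗ[ℝ] EuclideanSpace ℝ (Fin m))
    (c : EuclideanSpace ℝ (Fin m)) :
    (fun x => A x + c) '' C ⊆ E '' C' ↔
      ∀ y : WithLp 2 (EuclideanSpace ℝ (Fin m) × ℝ),
        LinearMap.adjoint (rmap E 0) y ∈ {w | ∀ k ∈ tau C', 0 ≤ ⟪k, w⟫} →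
        LinearMap.adjoint (rmap A c) y ∈ {w | ∀ k ∈ tau C, 0 ≤ ⟪k, w⟫} := by
  simp only [dual_iff, add_zero]
  constructor
  · intro h y hy x hx
    obtain ⟨z, hz, hzx⟩ := h ⟨x, hx, rfl⟩
    have := hy z hz
    rw [hzx] at this
    exact this
  · rintro h _ ⟨x, hx, rfl⟩
    by_contra hn
    have hcl : IsClosed (E '' C') :=
      (hC'cpt.image (LinearMap.continuous_of_finiteDimensional E)).isClosed
    obtain ⟨f, u, hfu, hu⟩ := geometric_hahn_banach_point_closed (hC'conv.linear_image E) hcl hn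
    have hf : ∀ z, ⟪z, (InnerProductSpace.toDual ℝ _).symm f⟫ = f z := by
      intro z
      rw [real_inner_comm, InnerProductSpace.toDual_symm_apply]
    have := h (WithLp.toLp 2 ((InnerProductSpace.toDual ℝ _).symm f, -u)) (by
      intro z hz
      have := hu (E z) ⟨z, hz, rfl⟩
      change 0 ≤ ⟪E z, (InnerProductSpace.toDual ℝ _).symm f⟫ + -u
      rw [hf]
      linarith) x hx
    change 0 ≤ ⟪A x + c, (InnerProductSpace.toDual ℝ _).symm f⟫ + -u at this
    rw [hf] at this
    change f (A x + c) < u at hfu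
    linarith
end

section
/- Let D ∈ ℝ^{n×n} be symmetric, d ∈ ℝⁿ, δ ∈ ℝ, and let K = {(x, z) ∈ ℝⁿ × ℝ : xᵀDx + 2dᵀx z + δ z² ≤ 0, z ≥ 0}. Assume K has nonempty interior and that the only point of K with z = 0 is the origin. Then K is a convex set if and only if D is positive definite. -/
open Matrix

/-- the cone `K = {(x, z) : xᵀDx + 2dᵀxz + δz² ≤ 0, z ≥ 0}` (with `D`
symmetric), assumed to have nonempty interior and to meet the hyperplane `z = 0` only at
the origin, is convex iff `D` is positive definite. -/
theorem stmt13 (n : ℕ) (D : Matrix (Fin n) (Fin n) ℝ) (hDsymm : D.IsSymm)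
    (d : Fin n → ℝ) (δ : ℝ)
    (K : Set ((Fin n → ℝ) × ℝ))
    (hK : K = {p : (Fin n → ℝ) × ℝ |
      p.1 ⬝ᵥ D.mulVec p.1 + 2 * (d ⬝ᵥ p.1) * p.2 + δ * p.2 ^ 2 ≤ 0 ∧ 0 ≤ p.2})
    (hint : (interior K).Nonempty)
    (hz : ∀ p ∈ K, p.2 = 0 → p = 0) :
    Convex ℝ K ↔ D.PosDef := by
  have hpos : ∀ x : Fin n → ℝ, x ≠ 0 → 0 < x ⬝ᵥ D.mulVec x := by
    intro x hx
    by_contra h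
    have h1 : ((x, 0) : (Fin n → ℝ) × ℝ) ∈ K := by
      rw [hK]
      simpa using h
    have h2 := hz _ h1 rfl
    exact hx (congrArg Prod.fst h2)
  have hnn : ∀ x : Fin n → ℝ, 0 ≤ x ⬝ᵥ D.mulVec x := by
    intro x
    by_cases hx : x = 0
    · simp [hx]
    · exact (hpos x hx).le
  have hPD : D.PosDef := by
    refine Matrix.PosDef.of_dotProduct_mulVec_pos ?_ ?_
    · simpa [Matrix.IsHermitian, Matrix.conjTranspose_eq_transpose_of_trivial] using hDsymm.eq
    · intro x hx
      simpa using hpos x hx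
  refine ⟨fun _ => hPD, fun _ => ?_⟩
  have hsym : ∀ x y : Fin n → ℝ, y ⬝ᵥ D.mulVec x = x ⬝ᵥ D.mulVec y := by
    intro x y
    rw [Matrix.dotProduct_mulVec, ← Matrix.mulVec_transpose, hDsymm.eq, dotProduct_comm]
  rintro ⟨x, z⟩ hp ⟨y, w⟩ hq a b ha hb -
  have hp0 := hz _ hp
  have hq0 := hz _ hq
  rw [hK] at hp hq ⊢
  obtain ⟨hp1, hp2⟩ := hp
  obtain ⟨hq1, hq2⟩ := hq
  simp only at hp1 hp2 hq1 hq2 hp0 hq0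
  have hF : x ⬝ᵥ D.mulVec y + (d ⬝ᵥ x) * w + (d ⬝ᵥ y) * z + δ * z * w ≤ 0 := by
    rcases hp2.eq_or_lt with h | h
    · have := hp0 h.symm
      simp only [Prod.mk_eq_zero] at this
      simp [this.1, this.2]
    rcases hq2.eq_or_lt with h' | h'
    · have := hq0 h'.symm
      simp only [Prod.mk_eq_zero] at this
      simp [this.1, this.2]
    have h3 := hnn (w • x - z • y)
    simp only [Matrix.mulVec_sub, Matrix.mulVec_smul, dotProduct_sub, sub_dotProduct,
      smul_dotProduct, dotProduct_smul, smul_eq_mul, hsym x y] at h3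
    have h4 := mul_nonneg (sq_nonneg w) (neg_nonneg.2 hp1)
    have h5 := mul_nonneg (sq_nonneg z) (neg_nonneg.2 hq1)
    have hzw := mul_pos h h'
    by_contra hc
    have h6 := mul_pos hzw (not_le.1 hc)
    nlinarith
  refine ⟨?_, ?_⟩
  · simp only [Prod.smul_mk, Prod.mk_add_mk, Matrix.mulVec_add, Matrix.mulVec_smul,
      dotProduct_add, add_dotProduct,
      smul_dotProduct, dotProduct_smul, smul_eq_mul, hsym x y]
    have h4 := mul_nonneg (sq_nonneg a) (neg_nonneg.2 hp1)
    have h5 := mul_nonneg (sq_nonneg b) (neg_nonneg.2 hq1)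
    have h6 := mul_nonneg (mul_nonneg ha hb) (neg_nonneg.2 hF)
    nlinarith
  · simp only [Prod.smul_mk, Prod.mk_add_mk, smul_eq_mul]
    positivity
end
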